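/- arXiv:2210.03577 — 2 statements merged into one kernel-verified Lean document; each statement's English description precedes it below -/
import Mathlib

section
/- (Lemma 1, part 1: the Calabi-Yau condition is preserved under the Berglund-Hübsch transpose.) Let A be an invertible n×n matrix with rational entries, let d and d_T be positive rational numbers, let w satisfy A·w = d·1 and let w_T satisfy Aᵀ·w_T = d_T·1. If ∑_i w_i = d, then ∑_i (w_T)_i = d_T. -/
open Matrix

theorem calabiYau_preserved_under_BH_transpose {n : ℕ} (A : Matrix (Fin n) (Fin n) ℚ)
    (hA : IsUnit A.det) (d dT : ℚ) (hd : 0 < d) (hdT : 0 < dT)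
    (w wT : Fin n → ℚ)
    (hw : A.mulVec w = fun _ => d) (hwT : Aᵀ.mulVec wT = fun _ => dT)
    (hCY : ∑ i, w i = d) :
    ∑ i, wT i = dT := by
  have h : wT ⬝ᵥ A *ᵥ w = Aᵀ *ᵥ wT ⬝ᵥ w := by
    rw [dotProduct_mulVec, mulVec_transpose]
  rw [hw, hwT] at h
  simp only [dotProduct, ← Finset.sum_mul, ← Finset.mul_sum, hCY] at h
  exact mul_right_cancel₀ hd.ne' h
end

section
/- (Lemma 1, part 2: the Fano condition is preserved under the Berglund-Hübsch transpose.) Let A be an invertible n×n matrix with rational entries, let d and d_T be positive rational numbers, let w satisfy A·w = d·1 and let w_T satisfy Aᵀ·w_T = d_T·1. If ∑_i w_i > d, then ∑_i (w_T)_i > d_T, i.e. |w_T| − d_T > 0. -/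
open Matrix

/-- If `A w = d 1` and `Aᵀ v = e 1`, then evaluating `v ⬝ᵥ A w` in two ways gives
`d ∑ v = e ∑ w`. -/
theorem mul_sum_eq_mul_sum_of_mulVec_eq_const {ι κ R : Type*} [Fintype ι] [Fintype κ]
    [CommSemiring R] {A : Matrix ι κ R} {d e : R} {w : κ → R} {v : ι → R}
    (hw : A.mulVec w = fun _ => d) (hv : Aᵀ.mulVec v = fun _ => e) :
    d * ∑ i, v i = e * ∑ j, w j := by
  have h : v ⬝ᵥ A.mulVec w = Aᵀ.mulVec v ⬝ᵥ w := by
    rw [dotProduct_mulVec, mulVec_transpose]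
  rw [hw, hv] at h
  simpa [dotProduct, Finset.mul_sum, mul_comm] using h

theorem fano_preserved_under_BH_transpose {n : ℕ} (A : Matrix (Fin n) (Fin n) ℚ)
    (hA : IsUnit A.det) (d dT : ℚ) (hd : 0 < d) (hdT : 0 < dT)
    (w wT : Fin n → ℚ)
    (hw : A.mulVec w = fun _ => d) (hwT : Aᵀ.mulVec wT = fun _ => dT)
    (hFano : d < ∑ i, w i) :
    dT < ∑ i, wT i := by
  have h := mul_sum_eq_mul_sum_of_mulVec_eq_const hw hwT
  refine lt_of_mul_lt_mul_left ?_ hd.le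
  rw [h, mul_comm d dT]
  exact mul_lt_mul_of_pos_left hFano hdT
end
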